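/- arXiv:2212.08580 — 2 statements merged into one kernel-verified Lean document; each statement's English description precedes it below -/
import Mathlib

section
/- For every integer n ≥ 1 and every integer s̄ with 0 ≤ s̄ ≤ n−1, there exists a family of matrices B_0, B_1, …, B_{s̄} ∈ ℝ^{n×n} such that for each σ ∈ {0,…,s̄}: (i) for every i ∈ {1,…,n}, the support of row i of B_σ is exactly the set of σ+1 cyclically consecutive indices {i, i+1, …, i+σ} taken modulo n (so in particular supp(row i of B_σ) ⊆ supp(row i of B_{σ+1}) whenever σ < s̄); and (ii) for every subset N ⊆ {1,…,n} of size n−σ, the all-ones row vector 1_{1×n} lies in the linear span of the rows of B_σ indexed by N. In other words, an (n, n, s̄) nested gradient code exists. -/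
open Polynomial in
lemma ngc_coeff_ne {n : ℕ} (ω : ℂ) (hω : IsPrimitiveRoot ω n) (K s : ℕ) (hK : K < n) (G : ℂ[X])
    (hG : G = ∏ t ∈ Finset.range K, (X - C (ω ^ (s + t)))) (hd : G.natDegree = K) (hm : G.Monic)
    (l : ℕ) (hl : l ≤ K) : G.coeff l ≠ 0 := by
  intro h0
  have hω0 : ω ≠ 0 := hω.ne_zero (by omega)
  let L : Fin (K + 1) := ⟨l, by omega⟩
  have hinj : Function.Injective (fun r : Fin K => ω ^ ((L.succAbove r : Fin (K+1)) : ℕ)) := by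
    intro a b hab
    have := hω.pow_inj (by omega) (by omega) hab
    exact Fin.succAbove_right_injective (Fin.ext this)
  have hz := Matrix.eq_zero_of_forall_pow_sum_mul_pow_eq_zero
    (v := fun r : Fin K => G.coeff (L.succAbove r : Fin (K+1)) * (ω ^ s) ^ ((L.succAbove r : Fin (K+1)) : ℕ)) hinj
    (by
      intro t
      have he : G.eval (ω ^ (s + t)) = 0 := by
        rw [hG, eval_prod]
        exact Finset.prod_eq_zero (Finset.mem_range.2 t.2) (by simp)
      rw [eval_eq_sum_range, hd,
        ← Fin.sum_univ_eq_sum_range (fun r => G.coeff r * (ω ^ (s + t)) ^ r) (K + 1),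
        Fin.sum_univ_succAbove _ L] at he
      simp only [L, h0, zero_mul, zero_add] at he
      rw [← he]
      refine Finset.sum_congr rfl fun r _ => ?_
      rw [mul_assoc]
      congr 1
      rw [← pow_mul, ← pow_mul, ← pow_mul, ← pow_add]
      congr 1
      simp only [L]
      ring)
  have hlast : G.coeff K = 1 := by rw [← hd]; exact hm
  by_cases hlK : l = K
  · subst hlK; rw [hlast] at h0; exact one_ne_zero h0
  · have hne : (Fin.last K) ≠ L := by
      intro h; apply hlK; exact (congrArg Fin.val h).symm
    obtain ⟨r, hr⟩ := Fin.exists_succAbove_eq hne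
    have := congrFun hz r
    simp only [hr, Fin.val_last, hlast, one_mul, Pi.zero_apply] at this
    exact pow_ne_zero _ (pow_ne_zero _ hω0) this

open Polynomial in
lemma ngc_core {n : ℕ} (ω : ℂ) (hω : IsPrimitiveRoot ω n) (K s : ℕ) (hK : K < n)
    (N : Finset (Fin n)) (hN : N.card = K + 1) (Q : ℂ[X]) (hQ : Q.natDegree ≤ K) :
    ∃ a : Fin n → ℂ, ∀ z : ℂ,
      ∑ i ∈ N, a i * ∏ t ∈ Finset.range K, (z - ω ^ ((i : ℕ) + (s + t))) = Q.eval z := by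
  have hω0 : ω ≠ 0 := hω.ne_zero (by omega)
  obtain ⟨G, hG⟩ : ∃ G : ℂ[X], G = ∏ t ∈ Finset.range K, (X - C (ω ^ (s + t))) := ⟨_, rfl⟩
  have hm : G.Monic := by rw [hG]; exact monic_prod_of_monic _ _ fun i _ => monic_X_sub_C _
  have hd : G.natDegree = K := by
    rw [hG, natDegree_prod_of_monic _ _ fun i _ => monic_X_sub_C _]; simp only [natDegree_X_sub_C]; simp
  have hc := ngc_coeff_ne ω hω K s hK G hG hd hm
  have hexp : ∀ (i : ℕ) (z : ℂ), ∏ t ∈ Finset.range K, (z - ω ^ (i + (s + t))) =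
      ∑ l ∈ Finset.range (K + 1), G.coeff l * (ω ^ i) ^ (K - l) * z ^ l := by
    intro i z
    have hy : ω ^ i ≠ 0 := pow_ne_zero _ hω0
    have h1 : ∏ t ∈ Finset.range K, (z - ω ^ (i + (s + t))) = (ω ^ i) ^ K * G.eval (z / ω ^ i) := by
      rw [hG, eval_prod, ← Finset.card_range K, ← Finset.prod_const, Finset.card_range,
        ← Finset.prod_mul_distrib]
      refine Finset.prod_congr rfl fun t _ => ?_
      simp only [eval_sub, eval_X, eval_C, pow_add]
      field_simp
    rw [h1, eval_eq_sum_range, hd, Finset.mul_sum]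
    refine Finset.sum_congr rfl fun l hl => ?_
    have hl' : l ≤ K := by simpa [Nat.lt_succ_iff] using hl
    obtain ⟨d, rfl⟩ := Nat.exists_eq_add_of_le hl'
    rw [Nat.add_sub_cancel_left, div_pow, pow_add]
    field_simp
  let e := N.equivFinOfCardEq hN
  let v : Fin (K + 1) → ℂ := fun r => ω ^ ((e.symm r : Fin n) : ℕ)
  have hv : Function.Injective v := by
    intro a b hab
    have := hω.pow_inj (e.symm a : Fin n).2 (e.symm b : Fin n).2 hab
    exact e.symm.injective (Subtype.ext (Fin.ext this))
  have hdet : IsUnit (Matrix.vandermonde v).det :=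
    isUnit_iff_ne_zero.2 (Matrix.det_vandermonde_ne_zero_iff.2 hv)
  let b : Fin (K + 1) → ℂ := fun r => Q.coeff (K - r) / G.coeff (K - r)
  let a' := Matrix.vecMul b (Matrix.vandermonde v)⁻¹
  have ha' : Matrix.vecMul a' (Matrix.vandermonde v) = b := by
    simp only [a', Matrix.vecMul_vecMul, Matrix.nonsing_inv_mul _ hdet, Matrix.vecMul_one]
  refine ⟨fun i => if h : i ∈ N then a' (e ⟨i, h⟩) else 0, fun z => ?_⟩
  have hsol : ∀ l ≤ K, ∑ r, a' r * v r ^ (K - l) = Q.coeff l / G.coeff l := by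
    intro l hl
    have := congrFun ha' ⟨K - l, by omega⟩
    simpa [Matrix.vecMul, dotProduct, Matrix.vandermonde_apply, b, Nat.sub_sub_self hl] using this
  rw [← Finset.sum_coe_sort, ← e.symm.sum_comp]
  simp only [hexp, Finset.coe_mem, dif_pos, Subtype.coe_eta, Equiv.apply_symm_apply]
  simp only [Finset.mul_sum]
  rw [Finset.sum_comm, eval_eq_sum_range' (Nat.lt_succ_of_le hQ)]
  refine Finset.sum_congr rfl fun l hl => ?_
  have hl' : l ≤ K := by simpa [Nat.lt_succ_iff] using hl
  have : Q.coeff l = G.coeff l * ∑ r, a' r * v r ^ (K - l) := by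
    rw [hsol l hl', mul_div_cancel₀ _ (hc l hl')]
  rw [this, Finset.mul_sum, Finset.sum_mul]
  refine Finset.sum_congr rfl fun r _ => ?_
  simp only [v]; ring

lemma ngc_sin (α β : ℝ) : ((Real.sin (α - β) : ℝ) : ℂ) *
    (2 * Complex.I * Complex.exp (α * Complex.I) * Complex.exp (β * Complex.I)) =
    Complex.exp (α * Complex.I) ^ 2 - Complex.exp (β * Complex.I) ^ 2 := by
  rw [Complex.ofReal_sin, Complex.sin]
  push_cast
  have h1 : Complex.exp ((α - β : ℂ) * Complex.I) = Complex.exp (α * Complex.I) * (Complex.exp (β * Complex.I))⁻¹ := by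
    rw [← Complex.exp_neg, ← Complex.exp_add]; ring_nf
  have h2 : Complex.exp (-(α - β : ℂ) * Complex.I) = (Complex.exp (α * Complex.I))⁻¹ * (Complex.exp (β * Complex.I)) := by
    rw [← Complex.exp_neg, ← Complex.exp_add]; ring_nf
  rw [h1, h2]
  have := Complex.exp_ne_zero (α * Complex.I)
  have := Complex.exp_ne_zero (β * Complex.I)
  field_simp
  rw [Complex.I_sq]
  ring

lemma ngc_den_pos (n : ℕ) (j : Fin n) :
    0 < Real.sin (Real.pi * (j : ℕ) / n - (-(Real.pi / (2 * n)))) := by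
  have hn0 : n ≠ 0 := by have := j.2; omega
  have hpos : ∀ j : Fin n, 0 < Real.sin (Real.pi * (j : ℕ) / n - (-(Real.pi / (2 * n)))) := by
    intro j
    have hnr : (0 : ℝ) < n := by exact_mod_cast Nat.pos_of_ne_zero hn0
    have hj : ((j : ℕ) : ℝ) + 1 ≤ n := by exact_mod_cast j.2
    have he : Real.pi * (j : ℕ) / n - (-(Real.pi / (2 * n))) = Real.pi * (((j : ℕ) + 1 / 2) / n) := by
      field_simp; ring
    rw [he]
    apply Real.sin_pos_of_pos_of_lt_pi
    · have := Real.pi_pos; positivity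
    · have : (((j : ℕ) : ℝ) + 1 / 2) / n < 1 := by rw [div_lt_one hnr]; linarith
      nlinarith [Real.pi_pos]
  exact hpos j

lemma ngc_den (n : ℕ) (j : Fin n) :
    Real.sin (Real.pi * (j : ℕ) / n - (-(Real.pi / (2 * n)))) ≠ 0 := (ngc_den_pos n j).ne'

open Polynomial in
lemma ngc_span (n K s : ℕ) (hK : K < n) (N : Finset (Fin n)) (hN : N.card = K + 1) :
    ∃ a : Fin n → ℝ, ∀ j : Fin n, ∑ i ∈ N, a i * ∏ t ∈ Finset.range K,
      (Real.sin (Real.pi * (j : ℕ) / n - Real.pi * ((i : ℕ) + (s + t) : ℕ) / n) /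
        Real.sin (Real.pi * (j : ℕ) / n - (-(Real.pi / (2 * n))))) = 1 := by
  have hn0 : n ≠ 0 := by omega
  let ω : ℂ := Complex.exp (2 * Real.pi * Complex.I / n)
  have hω : IsPrimitiveRoot ω n := Complex.isPrimitiveRoot_exp n hn0
  let u : ℕ → ℂ := fun m => Complex.exp ((Real.pi * m / n : ℝ) * Complex.I)
  let w : ℂ := Complex.exp ((-(Real.pi / (2 * n)) : ℝ) * Complex.I)
  have hu : ∀ m, u m ^ 2 = ω ^ m := by
    intro m
    simp only [u, ω, ← Complex.exp_nat_mul]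
    congr 1; push_cast; ring
  have hu0 : ∀ m, u m ≠ 0 := fun m => Complex.exp_ne_zero _
  have hw0 : w ≠ 0 := Complex.exp_ne_zero _
  have hpos := ngc_den_pos n
  obtain ⟨a, ha⟩ := ngc_core ω hω K s hK N hN ((X - C (w ^ 2)) ^ K) (by
    rw [natDegree_pow, natDegree_X_sub_C, mul_one])
  have hfac : ∀ (j : Fin n) (m : ℕ), ω ^ (j : ℕ) - ω ^ m = (w⁻¹ * u m) *
      ((Real.sin (Real.pi * (j : ℕ) / n - Real.pi * m / n) /
        Real.sin (Real.pi * (j : ℕ) / n - (-(Real.pi / (2 * n)))) : ℝ) : ℂ) * (ω ^ (j : ℕ) - w ^ 2) := by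
    intro j m
    have h1 := ngc_sin (Real.pi * (j : ℕ) / n) (Real.pi * m / n)
    have h2 := ngc_sin (Real.pi * (j : ℕ) / n) (-(Real.pi / (2 * n)))
    change _ * (2 * Complex.I * u j * u m) = u j ^ 2 - u m ^ 2 at h1
    change _ * (2 * Complex.I * u j * w) = u j ^ 2 - w ^ 2 at h2
    rw [hu, hu] at h1
    rw [hu] at h2
    rw [← h1, ← h2, Complex.ofReal_div]
    have h3 : ((Real.sin (Real.pi * (j : ℕ) / n - (-(Real.pi / (2 * n)))) : ℝ) : ℂ) ≠ 0 := by
      exact_mod_cast (hpos j).ne'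
    generalize ((Real.sin (Real.pi * (j : ℕ) / n - (-(Real.pi / (2 * n)))) : ℝ) : ℂ) = S at *
    field_simp
  have hq : ∀ j : Fin n, ω ^ (j : ℕ) - w ^ 2 ≠ 0 := by
    intro j
    have h2 := ngc_sin (Real.pi * (j : ℕ) / n) (-(Real.pi / (2 * n)))
    change _ * (2 * Complex.I * u j * w) = u j ^ 2 - w ^ 2 at h2
    rw [← hu, ← h2]
    have h3 : ((Real.sin (Real.pi * (j : ℕ) / n - (-(Real.pi / (2 * n)))) : ℝ) : ℂ) ≠ 0 := by
      exact_mod_cast (hpos j).ne'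
    have := hu0 j
    exact mul_ne_zero h3 (by simp [hw0, this])
  refine ⟨fun i => (a i * ∏ t ∈ Finset.range K, (w⁻¹ * u (i + (s + t)))).re, fun j => ?_⟩
  have h := ha (ω ^ (j : ℕ))
  simp only [eval_pow, eval_sub, eval_X, eval_C] at h
  simp only [fun m => hfac j m, Finset.prod_mul_distrib (g := fun _ => ω ^ (j : ℕ) - w ^ 2),
    Finset.prod_const, Finset.card_range, ← mul_assoc (a _)] at h
  rw [← Finset.sum_mul] at h
  have h' := mul_right_cancel₀ (pow_ne_zero K (hq j)) (h.trans (one_mul _).symm)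
  have h'' := congrArg Complex.re h'
  rw [Complex.re_sum, Complex.one_re] at h''
  rw [← h'']
  refine Finset.sum_congr rfl fun i _ => ?_
  rw [Finset.prod_mul_distrib, ← mul_assoc, ← Complex.ofReal_prod, Complex.re_mul_ofReal]

lemma ngc_sin_eq (n : ℕ) (hn : 1 ≤ n) (j m : ℕ) :
    Real.sin (Real.pi * j / n - Real.pi * m / n) = 0 ↔ ∃ k : ℤ, (j : ℤ) - m = k * n := by
  have hnr : (n : ℝ) ≠ 0 := by positivity
  rw [Real.sin_eq_zero_iff]
  refine exists_congr fun k => ?_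
  have h : Real.pi * j / n - Real.pi * m / n = (((j : ℝ) - m) / n) * Real.pi := by ring
  rw [h, mul_left_inj' Real.pi_ne_zero, eq_div_iff hnr]
  constructor
  · intro h; have : ((k * n : ℤ) : ℝ) = ((j - m : ℤ) : ℝ) := by push_cast; exact h
    exact_mod_cast this.symm
  · intro h; have : ((k * n : ℤ) : ℝ) = ((j - m : ℤ) : ℝ) := by exact_mod_cast h.symm
    push_cast at this; exact this

theorem nested_gradient_code_exists (n : ℕ) (hn : 1 ≤ n) (sbar : ℕ) (hsbar : sbar ≤ n - 1) :
    ∃ B : ℕ → Matrix (Fin n) (Fin n) ℝ,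
      ∀ σ ≤ sbar,
        -- (i) row supports are exactly σ+1 cyclically consecutive indices
        (∀ i : Fin n,
          {j : Fin n | B σ i j ≠ 0} =
            {j : Fin n | ∃ d : ℕ, d ≤ σ ∧ (j : ℕ) = ((i : ℕ) + d) % n}) ∧
        -- (ii) every n−σ rows span the all-ones vector
        (∀ N : Finset (Fin n), N.card = n - σ →
          (fun _ : Fin n => (1 : ℝ)) ∈
            Submodule.span ℝ ((fun i : Fin n => B σ i) '' (N : Set (Fin n)))) := by
  refine ⟨fun σ i j => ∏ t ∈ Finset.range (n - σ - 1),
      (Real.sin (Real.pi * (j : ℕ) / n - Real.pi * ((i : ℕ) + (σ + 1 + t) : ℕ) / n) /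
        Real.sin (Real.pi * (j : ℕ) / n - (-(Real.pi / (2 * n))))), fun σ hσ => ⟨fun i => ?_, fun N hN => ?_⟩⟩
  · ext j
    have hpos : Real.sin (Real.pi * (j : ℕ) / n - (-(Real.pi / (2 * n)))) ≠ 0 := ngc_den n j
    simp only [Set.mem_ofPred_eq, Finset.prod_ne_zero_iff, Finset.mem_range, ne_eq, div_eq_zero_iff,
      hpos, or_false, ngc_sin_eq n hn]
    have hi := i.2
    have hj := j.2
    constructor
    · intro h
      by_cases hij : (i : ℕ) ≤ j
      · refine ⟨j - i, ?_, ?_⟩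
        · by_contra hc
          refine h (j - i - (σ + 1)) (by omega) ⟨0, ?_⟩
          push_cast; omega
        · rw [Nat.add_sub_cancel' hij, Nat.mod_eq_of_lt hj]
      · refine ⟨j + n - i, ?_, ?_⟩
        · by_contra hc
          refine h (j + n - i - (σ + 1)) (by omega) ⟨-1, ?_⟩
          push_cast; omega
        · rw [Nat.add_sub_cancel' (by omega), Nat.add_mod_right, Nat.mod_eq_of_lt hj]
    · rintro ⟨d, hd, hjd⟩ t ht ⟨k, hk⟩
      have h1 := Nat.div_add_mod (i + d) n
      rw [← hjd] at h1
      generalize ((i : ℕ) + d) / n = q at h1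
      have h2 : ((n : ℤ) * q + j) = i + d := by exact_mod_cast h1
      push_cast at hk
      have h3 : (σ + 1 + t - d : ℤ) = n * (-k - q) := by linarith
      have h4 : (0 : ℤ) < n * (-k - q) := by omega
      have h5 : n * (-k - q) < (n : ℤ) * 1 := by omega
      have h6 := lt_of_mul_lt_mul_left h5 (by omega)
      have h7 := pos_of_mul_pos_right h4 (by omega)
      omega
  · obtain ⟨a, ha⟩ := ngc_span n (n - σ - 1) (σ + 1) (by omega) N (by omega)
    have : (fun _ : Fin n => (1 : ℝ)) = ∑ i ∈ N, a i • (fun j : Fin n => ∏ t ∈ Finset.range (n - σ - 1),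
      (Real.sin (Real.pi * (j : ℕ) / n - Real.pi * ((i : ℕ) + (σ + 1 + t) : ℕ) / n) /
        Real.sin (Real.pi * (j : ℕ) / n - (-(Real.pi / (2 * n)))))) := by
      funext j
      rw [Finset.sum_apply]
      simpa using (ha j).symm
    rw [this]
    exact Submodule.sum_mem _ fun i hi => Submodule.smul_mem _ _ (Submodule.subset_span ⟨i, hi, rfl⟩)
end

section
/- Let B ∈ ℝ^{n×k} and let s be an integer with 0 ≤ s < n. Suppose that for every subset S ⊆ {1,…,n} with |S| = s there exists a vector a ∈ ℝ^n with a_i = 0 for all i ∈ S and aᵀ B = 1_{1×k}. Then every column of B has at least s+1 nonzero entries; i.e., every partial gradient must be assigned to at least s+1 workers in any scheme that exactly recovers the sum in the presence of any s stragglers. -/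
/-!
STATEMENT 2: In any scheme that exactly recovers the sum in the presence of any `s`
stragglers, every partial gradient must be assigned to at least `s + 1` workers:
if for every straggler set `S` of size `s` there is a decoding vector `a` vanishing
on `S` with `aᵀ B = 1_{1×k}`, then every column of `B` has at least `s + 1` nonzero
entries.
-/

theorem gradient_code_column_weight
    (n k s : ℕ) (hs : s < n)
    (B : Matrix (Fin n) (Fin k) ℝ)
    (hrec : ∀ S : Finset (Fin n), S.card = s →
      ∃ a : Fin n → ℝ, (∀ i ∈ S, a i = 0) ∧
        Matrix.vecMul a B = fun _ : Fin k => (1 : ℝ)) :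
    ∀ j : Fin k, s + 1 ≤ (Finset.univ.filter fun i : Fin n => B i j ≠ 0).card := by
  intro j
  by_contra hlt
  have hle : (Finset.univ.filter fun i : Fin n => B i j ≠ 0).card ≤ s := by omega
  obtain ⟨S, hsub, hcard⟩ := Finset.exists_superset_card_eq hle
    (by rw [Fintype.card_fin]; exact hs.le)
  obtain ⟨a, ha, hB⟩ := hrec S hcard
  have h1 : ∑ i, a i * B i j = 1 := congrFun hB j
  have h0 : ∑ i, a i * B i j = 0 := by
    apply Finset.sum_eq_zero
    intro i _
    by_cases hb : B i j = 0
    · rw [hb, mul_zero]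
    · rw [ha i (hsub (Finset.mem_filter.mpr ⟨Finset.mem_univ i, hb⟩)), zero_mul]
  rw [h0] at h1
  exact zero_ne_one h1
end
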